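/- Let k be a field, 𝒩 a finite set, R = k[X_N : N ∈ 𝒩] the polynomial ring with its standard grading (each variable homogeneous of degree 1), and S₁ ⊆ 𝒩 a subset with both S₁ and 𝒩∖S₁ nonempty. Let I ⊆ R be a homogeneous ideal such that for every N' ∈ 𝒩∖S₁ some power of X_{N'} lies in I + ⟨X_N : N ∈ S₁⟩. Then there exist an integer d ≥ 1, a finite set M of functions m : 𝒩 → ℕ, and scalars λ_m ∈ k for m ∈ M, such that the homogeneous polynomial f := ∏_{N' ∈ 𝒩∖S₁} X_{N'}^d + Σ_{m ∈ M} λ_m · ∏_{N ∈ 𝒩} X_N^{m(N)} lies in I, where every m ∈ M satisfies: Σ_{N ∈ 𝒩} m(N) = d·|𝒩∖S₁|, m(N) ≥ 1 for at least one N ∈ S₁, and m(N') < d for all N' ∈ 𝒩∖S₁. -/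

import Mathlib

open MvPolynomial

namespace MvPolynomial

variable {σ k : Type*} [Field k]

/-- If `X i ^ d` lies in the sum of a homogeneous ideal `I` and the ideal of the variables in `S`,
then modulo `I` it is a form of degree `d` all of whose monomials involve a variable in `S`. -/
theorem exists_X_pow_sub_mem_of_mem_sup {I : Ideal (MvPolynomial σ k)}
    (hI : ∀ f ∈ I, ∀ n : ℕ, homogeneousComponent n f ∈ I) {S : Set σ} {i : σ} {d : ℕ}
    (h : (X i : MvPolynomial σ k) ^ d ∈ I ⊔ Ideal.span (X '' S)) :
    ∃ g : MvPolynomial σ k, X i ^ d - g ∈ I ∧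
      ∀ c ∈ g.support, c.degree = d ∧ ∃ j ∈ S, c j ≠ 0 := by
  obtain ⟨a, ha, b, hb, hab⟩ := Submodule.mem_sup.1 h
  refine ⟨homogeneousComponent d b, ?_, fun c hc => ?_⟩
  · have hX : homogeneousComponent d ((X i : MvPolynomial σ k) ^ d) = X i ^ d := by
      rw [homogeneousComponent_of_mem (isHomogeneous_X_pow i d), if_pos rfl]
    rw [← hX, ← hab, map_add, add_sub_cancel_right]
    exact hI a ha d
  · rw [mem_support_iff, coeff_homogeneousComponent] at hc
    have hdeg : c.degree = d := by
      by_contra hne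
      exact hc (if_neg hne)
    rw [if_pos hdeg] at hc
    exact ⟨hdeg, mem_ideal_span_X_image.1 hb c (mem_support_iff.2 hc)⟩

/-- If, modulo `I`, the `d`-th power of each variable in `T` is a form of degree `d` all of whose
monomials involve a variable outside `T`, then every monomial is congruent modulo `I` to a form of
the same degree whose exponents at `T` are all less than `d`. -/
theorem monomial_mem_restrictSupport_sup [Fintype σ] {I : Ideal (MvPolynomial σ k)}
    {T : Finset σ} {d : ℕ}
    (h : ∀ i ∈ T, ∃ g : MvPolynomial σ k, X i ^ d - g ∈ I ∧
      ∀ c ∈ g.support, c.degree = d ∧ ∃ j ∉ T, c j ≠ 0) (m : σ →₀ ℕ) :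
    monomial m (1 : k) ∈
      restrictSupport k {c | c.degree = m.degree ∧ ∀ i ∈ T, c i < d} ⊔
        I.restrictScalars k := by
  induction hn : ∑ i ∈ T, m i using Nat.strong_induction_on generalizing m with
  | _ n ih =>
  by_cases hm : ∀ i ∈ T, m i < d
  · exact Submodule.mem_sup_left
      ((monomial_mem_restrictSupport (R := k)).2 (Or.inl ⟨rfl, hm⟩))
  push Not at hm
  obtain ⟨i, hi, hdi⟩ := hm
  obtain ⟨g, hgI, hg⟩ := h i hi
  obtain ⟨r, rfl⟩ : ∃ r, m = r + Finsupp.single i d :=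
    ⟨m - Finsupp.single i d, (tsub_add_cancel_of_le (Finsupp.single_le_iff.2 hdi)).symm⟩
  have hsplit : monomial (r + Finsupp.single i d) (1 : k) =
      ∑ c ∈ g.support, coeff c g • monomial (r + c) (1 : k) +
        monomial r 1 * (X i ^ d - g) := by
    have hgr : monomial r (1 : k) * g =
        ∑ c ∈ g.support, coeff c g • monomial (r + c) (1 : k) := by
      conv_lhs => rw [as_sum g, Finset.mul_sum]
      simp [monomial_mul, smul_monomial]
    rw [mul_sub, hgr, X_pow_eq_monomial, monomial_mul, one_mul]
    abel
  rw [hsplit]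
  refine add_mem (sum_mem fun c hc => Submodule.smul_mem _ _ ?_)
    (Submodule.mem_sup_right (I.mul_mem_left _ hgI))
  obtain ⟨hcd, j, hjT, hj⟩ := hg c hc
  have hlt : ∑ a ∈ T, c a < d := by
    rw [← hcd, Finsupp.degree_eq_sum]
    exact Finset.sum_lt_sum_of_subset (Finset.subset_univ T) (Finset.mem_univ j) hjT
      (Nat.pos_of_ne_zero hj) fun _ _ _ => Nat.zero_le _
  have hdeg : (r + c).degree = (r + Finsupp.single i d).degree := by
    simp [hcd]
  rw [← hdeg]
  refine ih _ ?_ _ rfl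
  have hsingle : ∑ a ∈ T, Finsupp.single i d a = d := by
    classical simp [Finsupp.single_apply, hi]
  rw [← hn]
  simp only [Finsupp.add_apply, Finset.sum_add_distrib, hsingle]
  omega

end MvPolynomial

/-- Polynomial form of the key lemma: let `R = k[X_N : N ∈ 𝒩]` with its standard
grading, `S₁ ⊆ 𝒩` with `S₁` and its complement nonempty, and `I` a homogeneous
ideal such that every variable indexed outside `S₁` has some power lying in
`I + ⟨X_N : N ∈ S₁⟩`. Then `I` contains a homogeneous polynomial
`f = ∏_{N' ∉ S₁} X_{N'}^d + Σ_m λ_m ∏_N X_N^{m(N)}` where each exponent tuple `m`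
has total degree `d·|𝒩 \ S₁|`, satisfies `m(N) ≥ 1` for some `N ∈ S₁`, and
`m(N') < d` for all `N' ∉ S₁`. -/
theorem exists_special_homogeneous_elem
    {k : Type*} [Field k] {𝒩 : Type*} [Fintype 𝒩] [DecidableEq 𝒩]
    (S₁ : Finset 𝒩) (hS₁ : S₁.Nonempty) (hS₁c : S₁ᶜ.Nonempty)
    (I : Ideal (MvPolynomial 𝒩 k))
    -- `I` is homogeneous for the standard grading:
    (hIhom : ∀ f ∈ I, ∀ n : ℕ, (MvPolynomial.homogeneousComponent n) f ∈ I)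
    -- every variable outside `S₁` has a power in `I + ⟨X_N : N ∈ S₁⟩`:
    (hpow : ∀ N' ∈ S₁ᶜ, ∃ n : ℕ,
      (X N' : MvPolynomial 𝒩 k) ^ n ∈ I ⊔ Ideal.span ((fun N => (X N : MvPolynomial 𝒩 k)) '' S₁)) :
    ∃ (d : ℕ), 1 ≤ d ∧ ∃ (M : Finset (𝒩 → ℕ)) (lam : (𝒩 → ℕ) → k),
      ((∏ N' ∈ S₁ᶜ, (X N' : MvPolynomial 𝒩 k) ^ d) +
        ∑ m ∈ M, lam m • ∏ N : 𝒩, (X N : MvPolynomial 𝒩 k) ^ (m N)) ∈ I ∧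
      ∀ m ∈ M,
        (∑ N : 𝒩, m N = d * S₁ᶜ.card) ∧
        (∃ N ∈ S₁, 1 ≤ m N) ∧
        (∀ N' ∈ S₁ᶜ, m N' < d) := by
  choose! e he using hpow
  set d := ∑ i ∈ S₁ᶜ, e i + 1
  have hred : ∀ i ∈ S₁ᶜ, ∃ g : MvPolynomial 𝒩 k, X i ^ d - g ∈ I ∧
      ∀ c ∈ g.support, c.degree = d ∧ ∃ j ∉ S₁ᶜ, c j ≠ 0 := by
    intro i hi
    have hle : e i ≤ d :=
      (Finset.single_le_sum (fun _ _ => Nat.zero_le _) hi).trans (Nat.le_succ _)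
    obtain ⟨g, hgI, hg⟩ :=
      exists_X_pow_sub_mem_of_mem_sup hIhom (Ideal.pow_mem_of_pow_mem _ (he i hi) hle)
    refine ⟨g, hgI, fun c hc => ?_⟩
    obtain ⟨hcd, j, hj, hcj⟩ := hg c hc
    exact ⟨hcd, j, by simpa using hj, hcj⟩
  let p : 𝒩 →₀ ℕ := ∑ i ∈ S₁ᶜ, Finsupp.single i d
  have hp : monomial p (1 : k) = ∏ i ∈ S₁ᶜ, X i ^ d := by
    simp only [p, monomial_sum_one, X_pow_eq_monomial]
  have hpdeg : p.degree = d * S₁ᶜ.card := by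
    simp only [p, map_sum, Finsupp.degree_single, Finset.sum_const, smul_eq_mul, mul_comm]
  obtain ⟨v, hv, w, hw, hvw⟩ := Submodule.mem_sup.1 (monomial_mem_restrictSupport_sup hred p)
  rw [mem_restrictSupport_iff] at hv
  refine ⟨d, Nat.le_add_left _ _, v.support.map ⟨_, DFunLike.coe_injective⟩,
    fun m => -coeff (Finsupp.equivFunOnFinite.symm m) v, ?_, ?_⟩
  · have hsum : ∑ m ∈ v.support.map ⟨_, DFunLike.coe_injective⟩,
        -coeff (Finsupp.equivFunOnFinite.symm m) v •
          ∏ N : 𝒩, (X N : MvPolynomial 𝒩 k) ^ m N = -v := by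
      conv_rhs => rw [as_sum v]
      rw [Finset.sum_map, ← Finset.sum_neg_distrib]
      refine Finset.sum_congr rfl fun c _ => ?_
      rw [monomial_eq, Finsupp.prod_fintype _ _ fun _ => pow_zero _, ← smul_eq_C_mul]
      simp
    rw [hsum, ← hp, ← hvw, add_neg_cancel_comm]
    exact hw
  · intro m hm
    obtain ⟨c, hc, rfl⟩ := Finset.mem_map.1 hm
    obtain ⟨hcd, hcT⟩ := hv hc
    rw [hpdeg, Finsupp.degree_eq_sum] at hcd
    refine ⟨hcd, ?_, hcT⟩
    by_contra! hS
    have hzero : ∑ N ∈ S₁, c N = 0 :=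
      Finset.sum_eq_zero fun N hN => Nat.lt_one_iff.1 (hS N hN)
    have hlt : ∑ N ∈ S₁ᶜ, c N < ∑ _N ∈ S₁ᶜ, d := Finset.sum_lt_sum_of_nonempty hS₁c hcT
    rw [Finset.sum_const, smul_eq_mul, mul_comm, ← hcd, ← Finset.sum_add_sum_compl S₁, hzero,
      zero_add] at hlt
    exact lt_irrefl _ hlt
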